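/- Fix α > 0, a finite set of U users and B base stations, and peak rates c_{u,b} > 0. Suppose λ_b > 0 for all b, and suppose η* satisfies: (feasibility) η*_{u,b} ≥ 0 for all (u,b) and Σ_u η*_{u,b} = 1 for every b; (complementary slackness) for every (u,b), if η*_{u,b} > 0 then c_{u,b}/λ_b = max_{b'} c_{u,b'}/λ_{b'}; and (rate condition) Σ_b η*_{u,b} c_{u,b} = ( max_b c_{u,b}/λ_b )^{1/α} for every u. Then η* maximizes G(η) = Σ_u f_α( Σ_b η_{u,b} c_{u,b} ) over all feasible η (i.e., all η with η_{u,b} ≥ 0 and Σ_u η_{u,b} = 1 for every b). -/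

import Mathlib

/-- The α-fair utility, extended-real valued: `f_α(x) = x^(1−α)/(1−α)` for `α < 1`
(continuously extended by `f_α(0) = 0`), and for `α ≥ 1` it equals `log x` if `α = 1`
and `x^(1−α)/(1−α)` if `α > 1` on `x > 0`, taking the value `−∞` at `x = 0`. -/
noncomputable def fE (α x : ℝ) : EReal :=
  if α < 1 then ((x ^ (1 - α) / (1 - α) : ℝ) : EReal)
  else if x = 0 then ⊥
  else if α = 1 then ((Real.log x : ℝ) : EReal)
  else ((x ^ (1 - α) / (1 - α) : ℝ) : EReal)

theorem rpow_div_le_tangent_one {p t : ℝ} (hp : p ≠ 0) (hp1 : p < 1) (ht : 0 ≤ t)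
    (h : 0 < p ∨ 0 < t) : t ^ p / p ≤ 1 / p + (t - 1) := by
  rcases lt_or_gt_of_ne hp with hneg | hpos
  · have ht' : 0 < t := h.resolve_left hneg.not_gt
    have hexp : 1 + p * (t - 1) ≤ t ^ p := by
      rw [Real.rpow_def_of_pos ht']
      nlinarith [Real.add_one_le_exp (Real.log t * p), Real.log_le_sub_one_of_pos ht']
    rw [div_le_iff_of_neg hneg]
    calc (1 / p + (t - 1)) * p = 1 + p * (t - 1) := by field_simp
      _ ≤ t ^ p := hexp
  · have hb := rpow_one_add_le_one_add_mul_self (s := t - 1) (by linarith) hpos.le hp1.le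
    rw [add_sub_cancel] at hb
    rw [div_le_iff₀ hpos]
    calc t ^ p ≤ 1 + p * (t - 1) := hb
      _ = (1 / p + (t - 1)) * p := by field_simp

theorem rpow_div_le_tangent {p x y : ℝ} (hp : p ≠ 0) (hp1 : p < 1) (hx : 0 < x) (hy : 0 ≤ y)
    (h : 0 < p ∨ 0 < y) : y ^ p / p ≤ x ^ p / p + (y - x) * x ^ (p - 1) := by
  have ht := rpow_div_le_tangent_one hp hp1 (div_nonneg hy hx.le)
    (h.imp_right fun hy' => div_pos hy' hx)
  have hxp : 0 < x ^ p := Real.rpow_pos_of_pos hx p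
  have hmul := mul_le_mul_of_nonneg_left ht hxp.le
  rw [Real.div_rpow hy hx.le] at hmul
  rw [Real.rpow_sub_one hx.ne']
  calc y ^ p / p = x ^ p * (y ^ p / x ^ p / p) := by field_simp
    _ ≤ x ^ p * (1 / p + (y / x - 1)) := hmul
    _ = x ^ p / p + (y - x) * (x ^ p / x) := by field_simp

theorem log_le_tangent {x y : ℝ} (hx : 0 < x) (hy : 0 < y) :
    Real.log y ≤ Real.log x + (y - x) * x⁻¹ := by
  have h := Real.log_le_sub_one_of_pos (div_pos hy hx)
  rw [Real.log_div hy.ne' hx.ne'] at h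
  have : (y - x) * x⁻¹ = y / x - 1 := by field_simp
  linarith

/-- At a positive point `x` the utility is finite and lies below its tangent line there. -/
theorem fE_le_tangent {α x : ℝ} (hα : 0 < α) (hx : 0 < x) :
    ∃ v : ℝ, fE α x = v ∧ ∀ y, 0 ≤ y → fE α y ≤ ((v + (y - x) * x ^ (-α) : ℝ) : EReal) := by
  have hexp : (1 - α) - 1 = -α := by ring
  rcases lt_trichotomy α 1 with h | rfl | h
  · refine ⟨x ^ (1 - α) / (1 - α), by simp [fE, h], fun y hy => ?_⟩
    rw [fE, if_pos h, EReal.coe_le_coe_iff, ← hexp]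
    exact rpow_div_le_tangent (by linarith) (by linarith) hx hy (.inl (by linarith))
  · refine ⟨Real.log x, by simp [fE, hx.ne'], fun y hy => ?_⟩
    rcases hy.eq_or_lt with rfl | hy'
    · simp [fE]
    · rw [fE, if_neg (lt_irrefl _), if_neg hy'.ne', if_pos rfl, EReal.coe_le_coe_iff,
        Real.rpow_neg_one]
      exact log_le_tangent hx hy'
  · refine ⟨x ^ (1 - α) / (1 - α), by simp [fE, h.not_gt, hx.ne', h.ne'], fun y hy => ?_⟩
    rcases hy.eq_or_lt with rfl | hy'
    · simp [fE, h.not_gt]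
    · rw [fE, if_neg h.not_gt, if_neg hy'.ne', if_neg h.ne', EReal.coe_le_coe_iff, ← hexp]
      exact rpow_div_le_tangent (by linarith) (by linarith) hx hy (.inr hy')

theorem EReal.coe_finset_sum {ι : Type*} (s : Finset ι) (f : ι → ℝ) :
    ((∑ i ∈ s, f i : ℝ) : EReal) = ∑ i ∈ s, (f i : EReal) :=
  map_sum (⟨⟨Real.toEReal, EReal.coe_zero⟩, EReal.coe_add⟩ : ℝ →+ EReal) f s

/-- KKT sufficiency (Remark 1): if `η*` is feasible, satisfies complementary
slackness (`η*_{u,b} > 0` only if `c_{u,b}/λ_b` attains `max_{b'} c_{u,b'}/λ_{b'}`),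
and each user's throughput equals `(max_b c_{u,b}/λ_b)^(1/α)`, then `η*` maximizes
`G(η) = Σ_u f_α(Σ_b η_{u,b} c_{u,b})` over all feasible `η`. -/
theorem stmt11 (U B : ℕ) (hB : 0 < B) (α : ℝ) (hα : 0 < α)
    (c : Fin U → Fin B → ℝ) (hc : ∀ u b, 0 < c u b)
    (lam : Fin B → ℝ) (hlam : ∀ b, 0 < lam b)
    (η : Fin U → Fin B → ℝ)
    (hηpos : ∀ u b, 0 ≤ η u b) (hηsum : ∀ b, ∑ u, η u b = 1)
    (hcs : ∀ u b, 0 < η u b → c u b / lam b = ⨆ b', c u b' / lam b')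
    (hrate : ∀ u, ∑ b, η u b * c u b = (⨆ b', c u b' / lam b') ^ ((1 : ℝ) / α)) :
    ∀ η' : Fin U → Fin B → ℝ, (∀ u b, 0 ≤ η' u b) → (∀ b, ∑ u, η' u b = 1) →
      (∑ u, fE α (∑ b, η' u b * c u b)) ≤ ∑ u, fE α (∑ b, η u b * c u b) := by
  intro η' hη'pos hη'sum
  set M : Fin U → ℝ := fun u => ⨆ b, c u b / lam b with hM
  have hle : ∀ u b, c u b / lam b ≤ M u := fun u b =>
    le_ciSup (f := fun b => c u b / lam b) (Set.finite_range _).bddAbove b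
  have hMpos : ∀ u, 0 < M u := fun u =>
    (div_pos (hc u ⟨0, hB⟩) (hlam ⟨0, hB⟩)).trans_le (hle u ⟨0, hB⟩)
  have hx : ∀ u, 0 < ∑ b, η u b * c u b := fun u => by
    rw [hrate u]
    exact Real.rpow_pos_of_pos (hMpos u) _
  have hslope : ∀ u, (∑ b, η u b * c u b) ^ (-α) = (M u)⁻¹ := fun u => by
    rw [hrate u, ← Real.rpow_mul (hMpos u).le, ← Real.rpow_neg_one]
    congr 1
    field_simp
  choose v hv htangent using fun u => fE_le_tangent hα (hx u)
  have hopt : ∑ u, (∑ b, η u b * c u b) * (M u)⁻¹ = ∑ b, lam b := by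
    simp_rw [Finset.sum_mul]
    rw [Finset.sum_comm]
    refine Finset.sum_congr rfl fun b _ => ?_
    rw [← mul_one (lam b), ← hηsum b, Finset.mul_sum]
    refine Finset.sum_congr rfl fun u _ => ?_
    rcases (hηpos u b).eq_or_lt with h | h
    · simp [← h]
    · have hcM : c u b = M u * lam b := (div_eq_iff (hlam b).ne').mp (hcs u b h)
      rw [hcM]
      have := (hMpos u).ne'
      field_simp
  have hfeas : ∑ u, (∑ b, η' u b * c u b) * (M u)⁻¹ ≤ ∑ b, lam b := by
    simp_rw [Finset.sum_mul]
    rw [Finset.sum_comm]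
    refine Finset.sum_le_sum fun b _ => ?_
    rw [← mul_one (lam b), ← hη'sum b, Finset.mul_sum]
    refine Finset.sum_le_sum fun u _ => ?_
    have hcM : c u b ≤ M u * lam b := (div_le_iff₀ (hlam b)).mp (hle u b)
    rw [← div_eq_mul_inv, div_le_iff₀ (hMpos u)]
    calc η' u b * c u b ≤ η' u b * (M u * lam b) :=
          mul_le_mul_of_nonneg_left hcM (hη'pos u b)
      _ = lam b * η' u b * M u := by ring
  calc ∑ u, fE α (∑ b, η' u b * c u b)
      ≤ ∑ u, ((v u + (∑ b, η' u b * c u b - ∑ b, η u b * c u b) * (M u)⁻¹ : ℝ) : EReal) := by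
        refine Finset.sum_le_sum fun u _ => ?_
        rw [← hslope u]
        exact htangent u _ (Finset.sum_nonneg fun b _ => mul_nonneg (hη'pos u b) (hc u b).le)
    _ ≤ ∑ u, (v u : EReal) := by
        rw [← EReal.coe_finset_sum, ← EReal.coe_finset_sum, EReal.coe_le_coe_iff]
        simp_rw [sub_mul]
        rw [Finset.sum_add_distrib, Finset.sum_sub_distrib, hopt]
        linarith
    _ = ∑ u, fE α (∑ b, η u b * c u b) := Finset.sum_congr rfl fun u _ => (hv u).symm
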